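/- Let B be a Schauder basis of a Banach space X over 𝔽 and let w be a weight. If B is C_q-quasi-greedy and C_sd-w-disjoint-super-democratic, then B is C_sg-w-semi-greedy with C_sg ≤ C_q + 4C_q²C_sd. -/

import Mathlib

open scoped BigOperators NNReal

noncomputable section

/-- A semi-normalized strong Markushevich basis of a space `X` over `𝕜`. -/
structure MBasis (𝕜 : Type*) [RCLike 𝕜] (X : Type*) [NormedAddCommGroup X]
    [NormedSpace 𝕜 X] where
  /-- the basis vectors -/
  e : ℕ → X
  /-- the biorthogonal functionals -/
  f : ℕ → X →L[𝕜] 𝕜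
  /-- a positive lower bound for the norms: `c₁ = inf_n min (‖e n‖, ‖f n‖)` -/
  c₁ : ℝ
  /-- an upper bound for the norms: `c₂ = sup_n max (‖e n‖, ‖f n‖)` -/
  c₂ : ℝ
  c₁_pos : 0 < c₁
  c₁_le_e : ∀ n, c₁ ≤ ‖e n‖
  c₁_le_f : ∀ n, c₁ ≤ ‖f n‖
  e_le_c₂ : ∀ n, ‖e n‖ ≤ c₂
  f_le_c₂ : ∀ n, ‖f n‖ ≤ c₂
  biorth : ∀ j i, f j (e i) = if j = i then 1 else 0
  dense_span : closure (Submodule.span 𝕜 (Set.range e) : Set X) = Set.univ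
  total : ∀ x : X, (∀ j, f j x = 0) → x = 0
  strong : ∀ A : Set ℕ,
    closure (Submodule.span 𝕜 (e '' A) : Set X) = {x : X | ∀ j ∉ A, f j x = 0}

namespace MBasis

variable {𝕜 : Type*} [RCLike 𝕜] {X : Type*} [NormedAddCommGroup X] [NormedSpace 𝕜 X]

/-- A sign is a family of scalars of modulus one. -/
def IsSign (ε : ℕ → 𝕜) : Prop := ∀ n, ‖ε n‖ = 1

/-- `w(A) = Σ_{i ∈ A} w i` for a weight `w`. -/
def wSum (w : ℕ → ℝ) (A : Finset ℕ) : ℝ := ∑ i ∈ A, w i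

/-- The projection `P_A x = Σ_{n ∈ A} eₙ*(x) eₙ`. -/
def proj (b : MBasis 𝕜 X) (A : Finset ℕ) (x : X) : X := ∑ n ∈ A, b.f n x • b.e n

/-- `1_{εA} = Σ_{n ∈ A} εₙ eₙ`. -/
def indic (b : MBasis 𝕜 X) (ε : ℕ → 𝕜) (A : Finset ℕ) : X := ∑ n ∈ A, ε n • b.e n

/-- `Λ` is a greedy set of `x`: coefficients inside dominate those outside. -/
def IsGreedySet (b : MBasis 𝕜 X) (x : X) (Λ : Finset ℕ) : Prop :=
  ∀ n ∈ Λ, ∀ k, k ∉ Λ → ‖b.f k x‖ ≤ ‖b.f n x‖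

/-- `B` is a Schauder basis with basis constant (at most) `K`. -/
def SchauderConst (b : MBasis 𝕜 X) (K : ℝ) : Prop :=
  ∀ m : ℕ, ∀ x : X, ‖∑ j ∈ Finset.range m, b.f j x • b.e j‖ ≤ K * ‖x‖

/-- `B` is `C`-quasi-greedy. -/
def QuasiGreedy (b : MBasis 𝕜 X) (C : ℝ) : Prop :=
  ∀ x : X, ∀ Λ : Finset ℕ, b.IsGreedySet x Λ → ‖x - b.proj Λ x‖ ≤ C * ‖x‖

/-- `B` is `C`-`w`-almost-greedy. -/
def WAlmostGreedy (b : MBasis 𝕜 X) (w : ℕ → ℝ) (C : ℝ) : Prop :=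
  ∀ x : X, ∀ Λ : Finset ℕ, b.IsGreedySet x Λ →
    ∀ A : Finset ℕ, wSum w A ≤ wSum w Λ →
      ‖x - b.proj Λ x‖ ≤ C * ‖x - b.proj A x‖

/-- `B` is `C`-`w`-super-democratic. -/
def WSuperDemocratic (b : MBasis 𝕜 X) (w : ℕ → ℝ) (C : ℝ) : Prop :=
  ∀ A B : Finset ℕ, wSum w A ≤ wSum w B →
    ∀ ε ε' : ℕ → 𝕜, IsSign ε → IsSign ε' →
      ‖b.indic ε A‖ ≤ C * ‖b.indic ε' B‖

/-- `B` is `C`-`w`-disjoint-super-democratic. -/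
def WDisjSuperDemocratic (b : MBasis 𝕜 X) (w : ℕ → ℝ) (C : ℝ) : Prop :=
  ∀ A B : Finset ℕ, Disjoint A B → wSum w A ≤ wSum w B →
    ∀ ε ε' : ℕ → 𝕜, IsSign ε → IsSign ε' →
      ‖b.indic ε A‖ ≤ C * ‖b.indic ε' B‖

/-- `B` is `C`-`w`-democratic. -/
def WDemocratic (b : MBasis 𝕜 X) (w : ℕ → ℝ) (C : ℝ) : Prop :=
  ∀ A B : Finset ℕ, wSum w A ≤ wSum w B →
    ‖∑ n ∈ A, b.e n‖ ≤ C * ‖∑ n ∈ B, b.e n‖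

/-- `B` is `C`-`w`-semi-greedy: the Chebyshev greedy approximant supported on any greedy
set `Λ` does as well, up to the constant `C`, as any approximant supported on a set `A`
with `w(A) ≤ w(Λ)`. -/
def WSemiGreedy (b : MBasis 𝕜 X) (w : ℕ → ℝ) (C : ℝ) : Prop :=
  ∀ x : X, ∀ Λ : Finset ℕ, b.IsGreedySet x Λ →
    ∀ A : Finset ℕ, wSum w A ≤ wSum w Λ → ∀ a : ℕ → 𝕜,
      ∃ z ∈ Submodule.span 𝕜 (b.e '' (Λ : Set ℕ)),
        ‖x - z‖ ≤ C * ‖x - ∑ n ∈ A, a n • b.e n‖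

/-- `B` is `C`-super-democratic (unweighted). -/
def SuperDemocratic (b : MBasis 𝕜 X) (C : ℝ) : Prop :=
  ∀ A B : Finset ℕ, A.card ≤ B.card →
    ∀ ε ε' : ℕ → 𝕜, IsSign ε → IsSign ε' →
      ‖b.indic ε A‖ ≤ C * ‖b.indic ε' B‖

/-- `B` is `C`-disjoint-super-democratic (unweighted). -/
def DisjSuperDemocratic (b : MBasis 𝕜 X) (C : ℝ) : Prop :=
  ∀ A B : Finset ℕ, Disjoint A B → A.card ≤ B.card →
    ∀ ε ε' : ℕ → 𝕜, IsSign ε → IsSign ε' →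
      ‖b.indic ε A‖ ≤ C * ‖b.indic ε' B‖

/-- `B` is `C`-semi-greedy (unweighted). -/
def SemiGreedy (b : MBasis 𝕜 X) (C : ℝ) : Prop :=
  ∀ x : X, ∀ Λ : Finset ℕ, b.IsGreedySet x Λ →
    ∀ A : Finset ℕ, A.card ≤ Λ.card → ∀ a : ℕ → 𝕜,
      ∃ z ∈ Submodule.span 𝕜 (b.e '' (Λ : Set ℕ)),
        ‖x - z‖ ≤ C * ‖x - ∑ n ∈ A, a n • b.e n‖

/-- `B` is `ρ`-admissible. -/
def RhoAdmissible (b : MBasis 𝕜 X) (ρ : ℝ) : Prop :=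
  ∀ A : Finset ℕ, ∃ n₀ : ℕ, ∀ B : Finset ℕ, (∀ n ∈ B, n₀ ≤ n) → B.card ≤ A.card →
    ∀ α : ℕ → 𝕜, ‖∑ n ∈ A, α n • b.e n‖ ≤ ρ * ‖∑ n ∈ A ∪ B, α n • b.e n‖

/-- `B` has the `C`-Property (C). -/
def PropertyC (b : MBasis 𝕜 X) (C : ℝ) : Prop :=
  ∀ x : X, ∀ G : Finset ℕ, b.IsGreedySet x G → ∀ hG : G.Nonempty,
    ∀ ε : ℕ → 𝕜, IsSign ε →
      (G.inf' hG fun j => ‖b.f j x‖) * ‖b.indic ε G‖ ≤ C * ‖x‖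

/-- `B` is equivalent to the canonical basis of `c₀`. -/
def EquivC0 (b : MBasis 𝕜 X) : Prop :=
  ∃ c C : ℝ, 0 < c ∧ c ≤ C ∧ ∀ A : Finset ℕ, ∀ a : ℕ → 𝕜,
    c * (↑(A.sup fun n => ‖a n‖₊) : ℝ) ≤ ‖∑ n ∈ A, a n • b.e n‖ ∧
      ‖∑ n ∈ A, a n • b.e n‖ ≤ C * (↑(A.sup fun n => ‖a n‖₊) : ℝ)

/-- The subsequence `(e (σ k))_k` is equivalent to the canonical basis of `c₀`. -/
def SubseqEquivC0 (b : MBasis 𝕜 X) (σ : ℕ → ℕ) : Prop :=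
  ∃ c C : ℝ, 0 < c ∧ c ≤ C ∧ ∀ F : Finset ℕ, ∀ a : ℕ → 𝕜,
    c * (↑(F.sup fun k => ‖a k‖₊) : ℝ) ≤ ‖∑ k ∈ F, a k • b.e (σ k)‖ ∧
      ‖∑ k ∈ F, a k • b.e (σ k)‖ ≤ C * (↑(F.sup fun k => ‖a k‖₊) : ℝ)

end MBasis

open Classical in
/-- `κ = 1` if `𝕜 = ℝ` and `κ = 2` if `𝕜 = ℂ` (detected by whether `I = 0`). -/
noncomputable def kappa (𝕜 : Type*) [RCLike 𝕜] : ℝ :=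
  if (RCLike.I : 𝕜) = 0 then 1 else 2


variable {𝕜 : Type*} [RCLike 𝕜] {X : Type*} [NormedAddCommGroup X] [NormedSpace 𝕜 X]
  [CompleteSpace X]

open MBasis

theorem aux_f_sum (b : MBasis 𝕜 X) (S : Finset ℕ) (c : ℕ → 𝕜) (k : ℕ) :
    b.f k (∑ n ∈ S, c n • b.e n) = if k ∈ S then c k else 0 := by
  simp [map_sum, b.biorth]

theorem aux_mem_span (b : MBasis 𝕜 X) (L : Finset ℕ) (z : X) (h : ∀ j, j ∉ L → b.f j z = 0) :
    z ∈ Submodule.span 𝕜 (b.e '' (L : Set ℕ)) := by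
  have hz : z = ∑ n ∈ L, b.f n z • b.e n := by
    rw [← sub_eq_zero]
    apply b.total
    intro j
    rw [map_sub, aux_f_sum b L (fun n => b.f n z)]
    by_cases hj : j ∈ L
    · simp [hj]
    · simp [hj, h j hj]
  rw [hz]
  refine Submodule.sum_mem _ fun n hn => Submodule.smul_mem _ _ (Submodule.subset_span ?_)
  exact ⟨n, by simpa using hn, rfl⟩

theorem aux_finite (b : MBasis 𝕜 X) (v : X) (α : ℝ) (hα : 0 < α) :
    {n | α < ‖b.f n v‖}.Finite := by
  have hc2 : 0 < b.c₂ := lt_of_lt_of_le b.c₁_pos ((b.c₁_le_e 0).trans (b.e_le_c₂ 0))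
  have hv : v ∈ closure (Submodule.span 𝕜 (Set.range b.e) : Set X) := by
    rw [b.dense_span]; trivial
  obtain ⟨y, hy, hd⟩ := Metric.mem_closure_iff.1 hv (α / b.c₂) (by positivity)
  have hfin : ∀ y ∈ Submodule.span 𝕜 (Set.range b.e), {n | b.f n y ≠ 0}.Finite := by
    intro y hy
    induction hy using Submodule.span_induction with
    | mem x hx =>
      obtain ⟨i, rfl⟩ := hx
      refine (Set.finite_singleton i).subset fun n hn => ?_
      by_contra hne
      apply hn
      rw [b.biorth, if_neg (fun h => hne (by simp [h]))]
    | zero => simp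
    | add x y _ _ hx hy =>
      refine (hx.union hy).subset fun n hn => ?_
      by_contra hne
      simp only [Set.mem_union, Set.mem_setOf_eq, not_or, not_not] at hne
      apply hn
      rw [map_add, hne.1, hne.2, add_zero]
    | smul a x _ hx =>
      refine hx.subset fun n hn => ?_
      intro h0
      apply hn
      rw [map_smul, h0, smul_zero]
  refine (hfin y hy).subset fun n hn => ?_
  intro h0
  have h1 : ‖b.f n (v - y)‖ ≤ b.c₂ * ‖v - y‖ :=
    (b.f n).le_of_opNorm_le (b.f_le_c₂ n) _
  rw [map_sub, h0, sub_zero] at h1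
  rw [dist_eq_norm, lt_div_iff₀ hc2] at hd
  have : α < ‖b.f n v‖ := hn
  nlinarith

theorem aux_convex (b : MBasis 𝕜 X) (S : Finset ℕ) (M : ℝ)
    (hM : ∀ ε : ℕ → 𝕜, IsSign ε → ‖b.indic ε S‖ ≤ M) (T : Finset ℕ) :
    ∀ c : ℕ → 𝕜, (∀ n ∈ T, ‖c n‖ ≤ 1) → (∀ n, n ∉ T → ‖c n‖ = 1) →
      ‖∑ n ∈ S, c n • b.e n‖ ≤ M := by
  classical
  induction T using Finset.induction_on with
  | empty =>
    intro c _ h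
    exact hM c fun n => h n (by simp)
  | insert a T ha ih =>
    intro c h1 h2
    obtain ⟨u, hu, hcu⟩ : ∃ u : 𝕜, ‖u‖ = 1 ∧ c a = (‖c a‖ : 𝕜) * u := by
      by_cases h0 : c a = 0
      · exact ⟨1, by simp, by simp [h0]⟩
      · have h0' : (‖c a‖ : 𝕜) ≠ 0 := by simpa using h0
        refine ⟨c a / (‖c a‖ : 𝕜), ?_, by field_simp⟩
        rw [norm_div]; simp [h0]
    have key : ∀ t : 𝕜, ‖t‖ = 1 → ‖∑ n ∈ S, (Function.update c a t) n • b.e n‖ ≤ M := by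
      intro t ht
      apply ih
      · intro n hn
        have : n ≠ a := fun h => ha (h ▸ hn)
        rw [Function.update_of_ne this]
        exact h1 n (Finset.mem_insert_of_mem hn)
      · intro n hn
        by_cases hna : n = a
        · subst hna; simpa using ht
        · rw [Function.update_of_ne hna]
          exact h2 n (by simp [hna, hn])
    have hr := h1 a (Finset.mem_insert_self _ _)
    have hr0 := norm_nonneg (c a)
    set r := ‖c a‖ with hrdef
    have e : ∑ n ∈ S, c n • b.e n =
        (((1 + r) / 2 : ℝ) : 𝕜) • ∑ n ∈ S, (Function.update c a u) n • b.e n +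
        (((1 - r) / 2 : ℝ) : 𝕜) • ∑ n ∈ S, (Function.update c a (-u)) n • b.e n := by
      rw [Finset.smul_sum, Finset.smul_sum, ← Finset.sum_add_distrib]
      refine Finset.sum_congr rfl fun n _ => ?_
      rw [smul_smul, smul_smul, ← add_smul]
      congr 1
      by_cases hna : n = a
      · subst hna
        simp only [Function.update_self]
        rw [hcu]; push_cast; ring
      · simp only [Function.update_of_ne hna]
        push_cast; ring
    rw [e]
    refine (norm_add_le _ _).trans ?_
    rw [norm_smul, norm_smul, RCLike.norm_ofReal, RCLike.norm_ofReal,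
      abs_of_nonneg (by linarith), abs_of_nonneg (by linarith)]
    have k1 := key u hu
    have k2 := key (-u) (by simpa using hu)
    nlinarith

theorem aux_trunc (b : MBasis 𝕜 X) (Cq : ℝ) (hq : b.QuasiGreedy Cq) (v : X) (α : ℝ)
    (hα : 0 < α) (G : Finset ℕ) (hG : ∀ n, n ∈ G ↔ α < ‖b.f n v‖) :
    ‖v - ∑ n ∈ G, (((1 - α / ‖b.f n v‖ : ℝ) : 𝕜) * b.f n v) • b.e n‖ ≤ Cq * ‖v‖ := by
  classical
  letI : NormedSpace ℝ X := NormedSpace.restrictScalars ℝ 𝕜 X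
  haveI : IsScalarTower ℝ 𝕜 X := RestrictScalars.isScalarTower ℝ 𝕜 X
  let g : ℕ → ℝ → X := fun n =>
    (Set.Ioc (α / ‖b.f n v‖) 1).indicator (fun _ => b.f n v • b.e n)
  have hgi : ∀ n, MeasureTheory.IntegrableOn (g n) (Set.Ioc (0:ℝ) 1) := fun n =>
    MeasureTheory.Integrable.indicator
      (MeasureTheory.integrableOn_const (by simp)) measurableSet_Ioc
  have hgint : ∀ n ∈ G, ∫ s in Set.Ioc (0:ℝ) 1, g n s =
      (((1 - α / ‖b.f n v‖ : ℝ) : 𝕜) * b.f n v) • b.e n := by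
    intro n hn
    have hn' := (hG n).1 hn
    have hp : 0 < ‖b.f n v‖ := hα.trans hn'
    have hle : α / ‖b.f n v‖ ≤ 1 := by rw [div_le_one hp]; exact hn'.le
    have hge : 0 < α / ‖b.f n v‖ := by positivity
    rw [MeasureTheory.setIntegral_indicator measurableSet_Ioc, Set.inter_eq_right.2
      (Set.Ioc_subset_Ioc_left hge.le), MeasureTheory.setIntegral_const,
      MeasureTheory.measureReal_def, Real.volume_Ioc, ENNReal.toReal_ofReal (by linarith),
      RCLike.real_smul_eq_coe_smul (K := 𝕜), smul_smul]
  have htot : v - ∑ n ∈ G, (((1 - α / ‖b.f n v‖ : ℝ) : 𝕜) * b.f n v) • b.e n =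
      ∫ s in Set.Ioc (0:ℝ) 1, (v - ∑ n ∈ G, g n s) := by
    have hvi : MeasureTheory.IntegrableOn (fun _ : ℝ => v) (Set.Ioc (0:ℝ) 1) :=
      MeasureTheory.integrableOn_const (by simp)
    rw [MeasureTheory.integral_sub hvi
      (MeasureTheory.integrable_finsetSum _ fun n _ => hgi n),
      MeasureTheory.integral_finsetSum _ fun n _ => hgi n, Finset.sum_congr rfl hgint]
    simp
  rw [htot]
  have := MeasureTheory.norm_setIntegral_le_of_norm_le_const (μ := MeasureTheory.volume)
    (s := Set.Ioc (0:ℝ) 1) (f := fun s => v - ∑ n ∈ G, g n s) (C := Cq * ‖v‖) (by simp) ?_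
  · simpa using this
  intro s hs
  have hgs : ∑ n ∈ G, g n s = b.proj (G.filter fun n => α / ‖b.f n v‖ < s) v := by
    unfold MBasis.proj
    rw [Finset.sum_filter]
    refine Finset.sum_congr rfl fun n _ => ?_
    simp [g, Set.indicator, hs.2]
  simp only [hgs]
  apply hq
  intro n hn k hk
  simp only [Finset.mem_filter, hG] at hn hk
  by_cases hkG : α < ‖b.f k v‖
  · have h1 : s ≤ α / ‖b.f k v‖ := by
      by_contra hcon
      exact hk ⟨hkG, not_le.1 hcon⟩
    have h2 := hn.2.trans_le h1
    rw [div_lt_div_iff_of_pos_left hα (hα.trans hn.1) (hα.trans hkG)] at h2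
    exact h2.le
  · exact (not_lt.1 hkG).trans hn.1.le

/-- For a Schauder basis, quasi-greedy plus `w`-disjoint-super-democratic implies
`w`-semi-greedy with constant `C_q + 4 C_q² C_sd`. -/
theorem stmt4 (b : MBasis 𝕜 X) (w : ℕ → ℝ) (hw : ∀ n, 0 < w n) (Cq Csd : ℝ)
    (hSch : ∃ K : ℝ, b.SchauderConst K)
    (hq : b.QuasiGreedy Cq) (hsd : b.WDisjSuperDemocratic w Csd) :
    b.WSemiGreedy w (Cq + 4 * Cq ^ 2 * Csd) := by
  classical
  intro x L hL A hA a
  have he0 : 0 < ‖b.e 0‖ := b.c₁_pos.trans_le (b.c₁_le_e 0)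
  have hCq : 1 ≤ Cq := by
    have h := hq (b.e 0) ∅ (by intro n hn; simp at hn)
    simp only [MBasis.proj, Finset.sum_empty, sub_zero] at h
    by_contra hcon
    nlinarith
  have hCsd : 0 ≤ Csd := by
    have h := hsd ∅ {0} (by simp) (by simpa [wSum] using (hw 0).le) (fun _ => 1) (fun _ => 1)
      (fun _ => by simp) (fun _ => by simp)
    simp only [MBasis.indic, Finset.sum_empty, Finset.sum_singleton, one_smul, norm_zero] at h
    by_contra hcon
    nlinarith
  have hCC : 0 ≤ Cq ^ 2 * Csd := by positivity
  set v := x - ∑ n ∈ A, a n • b.e n with hv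
  have hv0 := norm_nonneg v
  rcases L.eq_empty_or_nonempty with rfl | hne
  · have hA0 : A = ∅ := by
      by_contra hcon
      have h := Finset.sum_pos (fun i _ => hw i) (Finset.nonempty_iff_ne_empty.2 hcon)
      simp only [wSum, Finset.sum_empty] at hA
      linarith
    refine ⟨0, Submodule.zero_mem _, ?_⟩
    have hvx : v = x := by rw [hv, hA0]; simp
    rw [sub_zero, ← hvx]
    nlinarith
  obtain ⟨n0, hn0, hmin⟩ := L.exists_min_image (fun n => ‖b.f n x‖) hne
  set α := ‖b.f n0 x‖ with hαdef
  have hout : ∀ k, k ∉ L → ‖b.f k x‖ ≤ α := fun k hk => hL n0 hn0 k hk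
  rcases (norm_nonneg (b.f n0 x)).eq_or_lt with h0 | hα
  · refine ⟨x, aux_mem_span b L x fun j hj => ?_, ?_⟩
    · have := hout j hj
      rw [hαdef, ← h0] at this
      exact norm_le_zero_iff.1 this
    · rw [sub_self, norm_zero]
      nlinarith
  rw [← hαdef] at hα
  have hfv : ∀ k, b.f k v = b.f k x - if k ∈ A then a k else 0 := by
    intro k
    rw [hv, map_sub, aux_f_sum]
  have hfin := aux_finite b v α hα
  let G := hfin.toFinset
  have hG : ∀ n, n ∈ G ↔ α < ‖b.f n v‖ := fun n => by simp [G]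
  have hT := aux_trunc b Cq hq v α hα G hG
  set T := v - ∑ n ∈ G, (((1 - α / ‖b.f n v‖ : ℝ) : 𝕜) * b.f n v) • b.e n with hTdef
  have hfT : ∀ k, b.f k T = if α < ‖b.f k v‖ then ((α / ‖b.f k v‖ : ℝ) : 𝕜) * b.f k v
      else b.f k v := by
    intro k
    rw [hTdef, map_sub, aux_f_sum b G (fun n => ((1 - α / ‖b.f n v‖ : ℝ) : 𝕜) * b.f n v)]
    by_cases hk : α < ‖b.f k v‖
    · rw [if_pos ((hG k).2 hk), if_pos hk]; push_cast; ring
    · rw [if_neg (fun h => hk ((hG k).1 h)), if_neg hk, sub_zero]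
  have hfTbig : ∀ k, α ≤ ‖b.f k v‖ → b.f k T = ((α / ‖b.f k v‖ : ℝ) : 𝕜) * b.f k v := by
    intro k hk
    rw [hfT]
    split_ifs with h
    · rfl
    · have : ‖b.f k v‖ = α := le_antisymm (not_lt.1 h) hk
      rw [this, div_self hα.ne']; simp
  have hnT : ∀ k, α ≤ ‖b.f k v‖ → ‖b.f k T‖ = α := by
    intro k hk
    have hp := hα.trans_le hk
    rw [hfTbig k hk, norm_mul, RCLike.norm_ofReal, abs_of_pos (by positivity)]
    field_simp
  have hleT : ∀ k, ‖b.f k T‖ ≤ α := by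
    intro k
    by_cases h : α ≤ ‖b.f k v‖
    · exact (hnT k h).le
    · rw [hfT, if_neg (fun h' => h h'.le)]
      exact (not_le.1 h).le
  have hDv : ∀ n ∈ L \ A, α ≤ ‖b.f n v‖ := by
    intro n hn
    rw [Finset.mem_sdiff] at hn
    rw [hfv, if_neg hn.2, sub_zero]
    exact hmin n hn.1
  -- the set `L \ A` is greedy for `T`
  have hDg : b.IsGreedySet T (L \ A) := by
    intro n hn k _
    rw [hnT n (hDv n hn)]
    exact hleT k
  have hPD : ‖b.proj (L \ A) T‖ ≤ 2 * Cq ^ 2 * ‖v‖ := by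
    have h1 := hq T _ hDg
    have h2 : ‖b.proj (L \ A) T‖ ≤ ‖T‖ + ‖T - b.proj (L \ A) T‖ := by
      have := norm_sub_le T (T - b.proj (L \ A) T)
      rwa [sub_sub_cancel] at this
    have h3 : ‖b.proj (L \ A) T‖ ≤ (1 + Cq) * ‖T‖ := by linarith
    have h4 : (1 + Cq) * ‖T‖ ≤ (2 * Cq) * (Cq * ‖v‖) :=
      mul_le_mul (by linarith) hT (norm_nonneg _) (by linarith)
    nlinarith
  -- signs on `L \ A`
  let ε' : ℕ → 𝕜 := fun n => if n ∈ L \ A then (((α⁻¹ : ℝ)) : 𝕜) * b.f n T else 1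
  have hε' : IsSign ε' := by
    intro n
    by_cases hn : n ∈ L \ A
    · simp only [ε', if_pos hn]
      rw [norm_mul, hnT n (hDv n hn), RCLike.norm_ofReal, abs_of_pos (by positivity)]
      field_simp
    · simp only [ε', if_neg hn, norm_one]
  have hind : b.indic ε' (L \ A) = ((α⁻¹ : ℝ) : 𝕜) • b.proj (L \ A) T := by
    unfold MBasis.indic MBasis.proj
    rw [Finset.smul_sum]
    refine Finset.sum_congr rfl fun n hn => ?_
    simp only [ε', if_pos hn]
    rw [mul_smul]
  have hindn : ‖b.indic ε' (L \ A)‖ ≤ α⁻¹ * (2 * Cq ^ 2 * ‖v‖) := by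
    rw [hind, norm_smul, RCLike.norm_ofReal, abs_of_pos (by positivity)]
    gcongr
  have hwle : wSum w (A \ L) ≤ wSum w (L \ A) := by
    have h1 := Finset.sum_inter_add_sum_sdiff A L w
    have h2 := Finset.sum_inter_add_sum_sdiff L A w
    rw [Finset.inter_comm] at h2
    unfold wSum at *
    linarith
  have hdisj : Disjoint (A \ L) (L \ A) := by
    rw [Finset.disjoint_left]
    intro n h1 h2
    rw [Finset.mem_sdiff] at h1 h2
    exact h1.2 h2.1
  have hM : ∀ ε : ℕ → 𝕜, IsSign ε →
      ‖b.indic ε (A \ L)‖ ≤ Csd * (α⁻¹ * (2 * Cq ^ 2 * ‖v‖)) := fun ε hε =>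
    (hsd _ _ hdisj hwle ε ε' hε hε').trans (by gcongr)
  -- the correction term
  let c : ℕ → 𝕜 := fun n =>
    if n ∈ A \ L then (((2 * α)⁻¹ : ℝ) : 𝕜) * (b.f n x - b.f n T) else 1
  have hc := aux_convex b (A \ L) _ hM (A \ L) c (by
    intro n hn
    simp only [c, if_pos hn]
    rw [norm_mul, RCLike.norm_ofReal, abs_of_pos (by positivity)]
    have h1 := norm_sub_le (b.f n x) (b.f n T)
    have h2 := hleT n
    have h3 := hout n (Finset.mem_sdiff.1 hn).2
    rw [inv_mul_le_iff₀ (by positivity)]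
    linarith) (by
    intro n hn
    simp only [c, if_neg hn, norm_one])
  set R := ∑ n ∈ A \ L, (b.f n x - b.f n T) • b.e n with hR
  have hRc : R = ((2 * α : ℝ) : 𝕜) • ∑ n ∈ A \ L, c n • b.e n := by
    rw [hR, Finset.smul_sum]
    refine Finset.sum_congr rfl fun n hn => ?_
    simp only [c, if_pos hn]
    rw [smul_smul, ← mul_assoc, ← RCLike.ofReal_mul, mul_inv_cancel₀ (by positivity)]
    simp
  have hRn : ‖R‖ ≤ 4 * Cq ^ 2 * Csd * ‖v‖ := by
    rw [hRc, norm_smul, RCLike.norm_ofReal, abs_of_pos (by positivity)]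
    refine (mul_le_mul_of_nonneg_left hc (by positivity)).trans (le_of_eq ?_)
    field_simp
    ring
  refine ⟨x - (T + R), aux_mem_span b L _ fun j hj => ?_, ?_⟩
  · rw [map_sub, map_add, hR, aux_f_sum b (A \ L) (fun n => b.f n x - b.f n T)]
    by_cases hjA : j ∈ A
    · rw [if_pos (Finset.mem_sdiff.2 ⟨hjA, hj⟩)]; ring
    · rw [if_neg (fun h => hjA (Finset.mem_sdiff.1 h).1)]
      have h1 : b.f j v = b.f j x := by rw [hfv, if_neg hjA, sub_zero]
      rw [hfT, if_neg (by rw [h1]; exact not_lt.2 (hout j hj)), h1]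
      ring
  · rw [sub_sub_cancel]
    have := norm_add_le T R
    linarith
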